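/- Let λ > 1/2 and ν > 1/2 be real with λ ≠ ν, and for real d near 4 (d ≠ 4) set R(d) = (Γ(1−d/2)/(2^d·π^(d/2)·(λ²−ν²))) · ( Γ((d−1)/2+ν)/Γ((3−d)/2+ν) − Γ((d−1)/2+λ)/Γ((3−d)/2+λ) ). Then, as d → 4 with d ≠ 4, the function d ↦ R(d) + 1/(8π²·(d−4)) tends to (1 − γ + log(4π))/(16π²) − 1/(8π²·(λ+ν)) + ( (1−4λ²)·ψ(λ−1/2) − (1−4ν²)·ψ(ν−1/2) ) / (32π²·(λ−ν)·(λ+ν)), where γ is the Euler–Mascheroni constant. -/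

import Mathlib

open Real Filter

/-- The digamma function `ψ(x) = Γ′(x)/Γ(x)`. -/
noncomputable def digamma (x : ℝ) : ℝ := deriv Real.Gamma x / Real.Gamma x

/-- The derivative of `Γ` at `x + 2`, expressed through the values at `x`. -/
lemma hasDerivAt_Gamma_add_two {x : ℝ} (hx : 0 < x) :
    HasDerivAt Real.Gamma
      ((x + 1) * x * deriv Real.Gamma x + (2 * x + 1) * Real.Gamma x) (x + 2) := by
  have hΓ : HasDerivAt Real.Gamma (deriv Real.Gamma x) (x + 2 - 2) := by
    rw [add_sub_cancel_right]
    exact (Real.differentiableOn_Gamma_Ioi.differentiableAt (Ioi_mem_nhds hx)).hasDerivAt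
  have hshift : HasDerivAt (fun y : ℝ => y - 2) 1 (x + 2) := (hasDerivAt_id _).sub_const 2
  have hprod := ((hshift.add_const 1).mul hshift).mul (hΓ.comp (x + 2) hshift)
  refine (hprod.congr_of_eventuallyEq ?_).congr_deriv ?_
  · filter_upwards [Ioi_mem_nhds (show (2 : ℝ) < x + 2 by linarith)] with y hy
    have hy : 2 < y := hy
    have h1 := Real.Gamma_add_one (s := y - 1) (by linarith)
    have h2 := Real.Gamma_add_one (s := y - 2) (by linarith)
    rw [show y - 1 + 1 = y by ring] at h1
    rw [show y - 2 + 1 = y - 1 by ring] at h2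
    simp only [Pi.mul_apply, Function.comp_apply]
    rw [h1, h2]
    ring
  · simp only [Pi.mul_apply, Function.comp_apply, add_sub_cancel_right]
    ring

/-- The value at `d = 4` of the quotient of Gamma functions in the bubble formula. -/
lemma Gamma_quotient_four {nu : ℝ} (hnu : 1 / 2 < nu) :
    Real.Gamma ((4 - 1) / 2 + nu) / Real.Gamma ((3 - 4) / 2 + nu) = nu ^ 2 - 1 / 4 := by
  have hpos : 0 < Real.Gamma (nu - 1 / 2) := Real.Gamma_pos_of_pos (by linarith)
  have h1 := Real.Gamma_add_one (s := nu + 1 / 2) (by linarith)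
  have h2 := Real.Gamma_add_one (s := nu - 1 / 2) (by linarith)
  rw [show nu - 1 / 2 + 1 = nu + 1 / 2 by ring] at h2
  rw [show (4 - 1) / 2 + nu = nu + 1 / 2 + 1 by ring,
    show (3 - 4) / 2 + nu = nu - 1 / 2 by ring, h1, h2, ← mul_assoc,
    mul_div_cancel_right₀ _ hpos.ne']
  ring

/-- The derivative at `d = 4` of the quotient of Gamma functions in the bubble formula. -/
lemma hasDerivAt_Gamma_quotient_four {nu : ℝ} (hnu : 1 / 2 < nu) :
    HasDerivAt (fun d : ℝ => Real.Gamma ((d - 1) / 2 + nu) / Real.Gamma ((3 - d) / 2 + nu))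
      ((nu ^ 2 - 1 / 4) * digamma (nu - 1 / 2) + nu) 4 := by
  have hx : 0 < nu - 1 / 2 := by linarith
  have hpos : 0 < Real.Gamma (nu - 1 / 2) := Real.Gamma_pos_of_pos hx
  have hnum : HasDerivAt (fun d : ℝ => (d - 1) / 2 + nu) (1 / 2) 4 :=
    (((hasDerivAt_id _).sub_const 1).div_const 2).add_const nu
  have hden : HasDerivAt (fun d : ℝ => (3 - d) / 2 + nu) (-1 / 2) 4 :=
    (((hasDerivAt_id _).const_sub 3).div_const 2).add_const nu
  have hnum4 : (4 - 1) / 2 + nu = nu - 1 / 2 + 2 := by ring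
  have hden4 : (3 - 4) / 2 + nu = nu - 1 / 2 := by ring
  have hΓnum := hasDerivAt_Gamma_add_two hx
  have hΓden : HasDerivAt Real.Gamma (deriv Real.Gamma (nu - 1 / 2)) (nu - 1 / 2) :=
    (Real.differentiableOn_Gamma_Ioi.differentiableAt (Ioi_mem_nhds hx)).hasDerivAt
  have hval := Gamma_quotient_four hnu
  rw [hden4, div_eq_iff hpos.ne'] at hval
  rw [← hnum4] at hΓnum
  rw [← hden4] at hΓden
  have h := (hΓnum.comp 4 hnum).div (hΓden.comp 4 hden) (by
    simp only [Function.comp_apply]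
    rw [hden4]
    exact hpos.ne')
  refine h.congr_deriv ?_
  simp only [Function.comp_apply]
  rw [hval, hden4, digamma]
  have hG := hpos.ne'
  generalize Real.Gamma (nu - 1 / 2) = G at hG ⊢
  field_simp
  ring

/-- The bubble formula with the simple pole of `Γ(1 - d/2)` at `d = 4` removed. -/
noncomputable def bubbleRegularPart (lam nu d : ℝ) : ℝ :=
  Real.Gamma (3 - d / 2) / ((1 - d / 2) * (2 ^ d * Real.pi ^ (d / 2) * (lam ^ 2 - nu ^ 2))) *
    (Real.Gamma ((d - 1) / 2 + nu) / Real.Gamma ((3 - d) / 2 + nu) -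
      Real.Gamma ((d - 1) / 2 + lam) / Real.Gamma ((3 - d) / 2 + lam))

lemma two_rpow_mul_pi_rpow_four : (2 : ℝ) ^ (4 : ℝ) * Real.pi ^ ((4 : ℝ) / 2) =
    16 * Real.pi ^ 2 := by
  rw [show (4 : ℝ) / 2 = (2 : ℕ) by norm_num, Real.rpow_natCast,
    show (4 : ℝ) = (4 : ℕ) by norm_num, Real.rpow_natCast]
  norm_num

lemma bubbleRegularPart_four {lam nu : ℝ} (hlam : 1 / 2 < lam) (hnu : 1 / 2 < nu)
    (hne : lam ≠ nu) : bubbleRegularPart lam nu 4 = 1 / (16 * Real.pi ^ 2) := by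
  have hsub : lam - nu ≠ 0 := sub_ne_zero.mpr hne
  have hadd : lam + nu ≠ 0 := by linarith
  have hsq : lam ^ 2 - nu ^ 2 ≠ 0 := by
    rw [sq_sub_sq]
    exact mul_ne_zero hadd hsub
  rw [bubbleRegularPart, Gamma_quotient_four hlam, Gamma_quotient_four hnu,
    two_rpow_mul_pi_rpow_four, show (3 : ℝ) - 4 / 2 = 1 by norm_num, Real.Gamma_one]
  field_simp
  ring

lemma hasDerivAt_bubbleRegularPart_four {lam nu : ℝ} (hlam : 1 / 2 < lam) (hnu : 1 / 2 < nu)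
    (hne : lam ≠ nu) :
    HasDerivAt (bubbleRegularPart lam nu)
      (-((1 - Real.eulerMascheroniConstant + Real.log (4 * Real.pi)) / (16 * Real.pi ^ 2) -
            1 / (8 * Real.pi ^ 2 * (lam + nu)) +
          ((1 - 4 * lam ^ 2) * digamma (lam - 1 / 2) -
              (1 - 4 * nu ^ 2) * digamma (nu - 1 / 2)) /
            (32 * Real.pi ^ 2 * (lam - nu) * (lam + nu))) / 2) 4 := by
  have hsub : lam - nu ≠ 0 := sub_ne_zero.mpr hne
  have hadd : lam + nu ≠ 0 := by linarith
  have hsq : lam ^ 2 - nu ^ 2 = (lam + nu) * (lam - nu) := sq_sub_sq _ _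
  have hhalf : HasDerivAt (fun d : ℝ => d / 2) (1 / 2) 4 := (hasDerivAt_id _).div_const 2
  have hΓ : HasDerivAt Real.Gamma (-Real.eulerMascheroniConstant) (3 - 4 / 2) := by
    rw [show (3 : ℝ) - 4 / 2 = 1 by norm_num]
    exact Real.hasDerivAt_Gamma_one
  have hpow := ((hasDerivAt_id (4 : ℝ)).const_rpow two_pos).mul (hhalf.const_rpow Real.pi_pos)
  have hden := (hhalf.const_sub 1).mul (hpow.mul_const (lam ^ 2 - nu ^ 2))
  have hden4 : (1 - (4 : ℝ) / 2) * ((2 : ℝ) ^ (4 : ℝ) * Real.pi ^ ((4 : ℝ) / 2) *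
      (lam ^ 2 - nu ^ 2)) ≠ 0 := by
    rw [two_rpow_mul_pi_rpow_four, hsq]
    norm_num
    exact ⟨hadd, hsub⟩
  have h := ((hΓ.comp 4 (hhalf.const_sub 3)).div hden hden4).mul
    ((hasDerivAt_Gamma_quotient_four hnu).sub (hasDerivAt_Gamma_quotient_four hlam))
  refine h.congr_deriv ?_
  simp only [Pi.mul_apply, Pi.sub_apply, Pi.div_apply, Function.comp_apply, id_eq]
  have hlog : Real.log (4 * Real.pi) = 2 * Real.log 2 + Real.log Real.pi := by
    rw [Real.log_mul (by norm_num) Real.pi_ne_zero, show (4 : ℝ) = 2 ^ 2 by norm_num,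
      Real.log_pow]
    norm_num
  have h2 : (2 : ℝ) ^ (4 : ℝ) = 16 := by
    rw [show (4 : ℝ) = (4 : ℕ) by norm_num, Real.rpow_natCast]
    norm_num
  have hpi : Real.pi ^ ((4 : ℝ) / 2) = Real.pi ^ 2 := by
    rw [show (4 : ℝ) / 2 = (2 : ℕ) by norm_num, Real.rpow_natCast]
  rw [Gamma_quotient_four hlam, Gamma_quotient_four hnu, hlog, h2, hpi, hsq,
    show (3 : ℝ) - 4 / 2 = 1 by norm_num, Real.Gamma_one, show (1 : ℝ) - 4 / 2 = -1 by norm_num]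
  field_simp
  ring

lemma Gamma_one_sub_half {d : ℝ} (h2 : d ≠ 2) (h4 : d ≠ 4) :
    Real.Gamma (1 - d / 2) = -2 / (d - 4) * (Real.Gamma (3 - d / 2) / (1 - d / 2)) := by
  have h1' : 1 - d / 2 ≠ 0 := fun h => h2 (by linarith)
  have h2' : 2 - d / 2 ≠ 0 := fun h => h4 (by linarith)
  have h4' : d - 4 ≠ 0 := sub_ne_zero.mpr h4
  have e1 := Real.Gamma_add_one h1'
  have e2 := Real.Gamma_add_one h2'
  rw [show 1 - d / 2 + 1 = 2 - d / 2 by ring] at e1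
  rw [show 2 - d / 2 + 1 = 3 - d / 2 by ring] at e2
  rw [e2, e1, mul_left_comm, mul_div_cancel_left₀ _ h1']
  field_simp
  ring

/-- Laurent expansion of the one-loop bubble near `d = 4`: the pole-subtracted bubble formula
has the stated finite limit as `d → 4`. -/
theorem bubble_laurent_dim_four (lam nu : ℝ) (hlam : 1 / 2 < lam) (hnu : 1 / 2 < nu)
    (hne : lam ≠ nu) :
    Tendsto
      (fun d : ℝ =>
        Real.Gamma (1 - d / 2) / (2 ^ d * Real.pi ^ (d / 2) * (lam ^ 2 - nu ^ 2)) *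
            (Real.Gamma ((d - 1) / 2 + nu) / Real.Gamma ((3 - d) / 2 + nu) -
              Real.Gamma ((d - 1) / 2 + lam) / Real.Gamma ((3 - d) / 2 + lam)) +
          1 / (8 * Real.pi ^ 2 * (d - 4)))
      (nhdsWithin 4 {(4 : ℝ)}ᶜ)
      (nhds
        ((1 - Real.eulerMascheroniConstant + Real.log (4 * Real.pi)) / (16 * Real.pi ^ 2) -
            1 / (8 * Real.pi ^ 2 * (lam + nu)) +
          ((1 - 4 * lam ^ 2) * digamma (lam - 1 / 2) -
              (1 - 4 * nu ^ 2) * digamma (nu - 1 / 2)) /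
            (32 * Real.pi ^ 2 * (lam - nu) * (lam + nu)))) := by
  have hslope := (hasDerivAt_iff_tendsto_slope.mp
    (hasDerivAt_bubbleRegularPart_four hlam hnu hne)).const_mul (-2)
  rw [show ∀ a : ℝ, -2 * (-a / 2) = a from fun a => by ring] at hslope
  refine hslope.congr' ?_
  filter_upwards [self_mem_nhdsWithin,
    mem_nhdsWithin_of_mem_nhds (isOpen_ne.mem_nhds (show (4 : ℝ) ≠ 2 by norm_num))] with d h4 h2
  have h4' : d - 4 ≠ 0 := sub_ne_zero.mpr h4
  rw [slope_def_field, bubbleRegularPart_four hlam hnu hne, Gamma_one_sub_half h2 h4,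
    bubbleRegularPart, ← div_div]
  have hpi := Real.pi_ne_zero
  field_simp
  ring
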